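/- Let d ≥ 2 and let (F_n)_{n∈ℕ} be the Eden growth model in ℤ^d, i.e. incremental aggregation with distribution family (μ_A) where μ_A is the uniform probability measure on A for each finite nonempty A ⊆ ℤ^d. Then there exists a constant c > 0 such that ℙ( there exists N ∈ ℕ such that for all n ≥ N, rad(F_n) ≤ c·n^{1/2} ) = 1. -/

import Mathlib

open MeasureTheory Filter

/-- Euclidean norm of a lattice point. -/
noncomputable def zNorm {d : ℕ} (x : Fin d → ℤ) : ℝ :=
  Real.sqrt (∑ i, ((x i : ℝ)) ^ 2)

/-- Two lattice points are adjacent (nearest neighbours) if their Euclidean distance is 1. -/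
def adjPt {d : ℕ} (x y : Fin d → ℤ) : Prop := zNorm (x - y) = 1

/-- The radius of a finite set: the maximal Euclidean norm of its points. -/
noncomputable def rad {d : ℕ} (A : Finset (Fin d → ℤ)) : ℝ :=
  if h : A.Nonempty then A.sup' h zNorm else 0

/-- A finite set is connected in the nearest-neighbour graph on `ℤ^d`. -/
def IsConnCluster {d : ℕ} (A : Finset (Fin d → ℤ)) : Prop :=
  ∀ x ∈ A, ∀ y ∈ A,
    Relation.ReflTransGen (fun a b => a ∈ A ∧ b ∈ A ∧ adjPt a b) x y

/-- The outer boundary of a set `A ⊆ ℤ^d`: the points outside `A` adjacent to a point of `A`. -/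
def obdry {d : ℕ} (A : Set (Fin d → ℤ)) : Set (Fin d → ℤ) :=
  {y | y ∉ A ∧ ∃ x ∈ A, adjPt x y}

/-- `B ∈ P^d_∂`: `B` is the outer boundary of some finite connected set containing `0`. -/
def IsOuterBdry {d : ℕ} (B : Finset (Fin d → ℤ)) : Prop :=
  ∃ A : Finset (Fin d → ℤ), IsConnCluster A ∧ (0 : Fin d → ℤ) ∈ A ∧
    (B : Set (Fin d → ℤ)) = obdry (A : Set (Fin d → ℤ))

/-- A family of probability distributions `μ_A` supported on `A`,
for each finite nonempty `A ⊆ ℤ^d`. -/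
def IsDistFamily {d : ℕ} (μ : Set (Fin d → ℤ) → (Fin d → ℤ) → ℝ) : Prop :=
  ∀ A : Set (Fin d → ℤ), A.Finite → A.Nonempty →
    (∀ z, 0 ≤ μ A z) ∧ (∀ z, z ∉ A → μ A z = 0) ∧ (∑' z, μ A z = 1)

/-- `(F_n)` with attachment points `(y_n)` is incremental aggregation with distribution
family `μ`: `F_1 = {0}` and `y_1 = 0` a.s., `F_{n+1} = F_n ∪ {y_{n+1}}`, and given
`F_n = A` the point `y_{n+1}` is distributed according to `μ_{∂A}`. -/
def IsIncrementalAggregation {d : ℕ} {Ω : Type*} [MeasurableSpace Ω]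
    (P : Measure Ω) (μ : Set (Fin d → ℤ) → (Fin d → ℤ) → ℝ)
    (F : ℕ → Ω → Finset (Fin d → ℤ)) (y : ℕ → Ω → (Fin d → ℤ)) : Prop :=
  (∀ᵐ ω ∂P, F 1 ω = {0} ∧ y 1 ω = 0) ∧
  (∀ n : ℕ, 1 ≤ n → ∀ ω, F (n + 1) ω = insert (y (n + 1) ω) (F n ω)) ∧
  (∀ n : ℕ, 1 ≤ n → ∀ A : Finset (Fin d → ℤ), ∀ v : Fin d → ℤ,
    P ({ω | y (n + 1) ω = v} ∩ {ω | F n ω = A}) =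
      ENNReal.ofReal (μ (obdry (A : Set (Fin d → ℤ))) v) * P {ω | F n ω = A})

open Classical in
/-- The uniform distribution family: `μ_A` is the uniform probability measure on `A`. -/
noncomputable def unifFam {d : ℕ} : Set (Fin d → ℤ) → (Fin d → ℤ) → ℝ :=
  fun A z => if z ∈ A then 1 / (A.ncard : ℝ) else 0

/-! ### Isoperimetry -/

/-- From a point of a finite set one can leave the set in the direction of coordinate `i`. -/
lemma exists_top {d : ℕ} (A : Finset (Fin d → ℤ)) (i : Fin d) (x : Fin d → ℤ) (hx : x ∈ A) :
    ∃ z ∈ obdry (A : Set (Fin d → ℤ)), ∀ j, j ≠ i → z j = x j := by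
  classical
  have hinj : Function.Injective (fun k : ℕ => x + Pi.single i (k : ℤ)) := by
    intro k l h
    have := congrFun h i
    simpa using this
  have hex : ∃ k : ℕ, x + Pi.single i (k : ℤ) ∉ A := by
    by_contra! h
    exact Set.infinite_of_injective_forall_mem hinj (s := (A : Set (Fin d → ℤ))) h A.finite_toSet
  have hk := Nat.find_spec hex
  have hmin := fun m => Nat.find_min hex (m := m)
  set k := Nat.find hex
  have hk0 : k ≠ 0 := by
    intro h0
    rw [h0] at hk
    simp [hx] at hk
  obtain ⟨l, hl⟩ := Nat.exists_eq_succ_of_ne_zero hk0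
  have hlA := hmin l (by omega)
  push Not at hlA
  refine ⟨x + Pi.single i (k : ℤ), ⟨by simpa using hk, _, hlA, ?_⟩, ?_⟩
  · have : x + Pi.single i (l : ℤ) - (x + Pi.single i (k : ℤ)) = Pi.single i (-1) := by
      rw [add_sub_add_left_eq_sub, ← Pi.single_sub, hl]
      congr 1
      push_cast
      ring
    unfold adjPt zNorm
    rw [this, Finset.sum_eq_single i]
    · simp
    · intro j _ hj
      simp [Pi.single_eq_of_ne hj]
    · simp
  · intro j hj
    simp [Pi.single_eq_of_ne hj]

lemma card_le_sq {d : ℕ} (hd : 2 ≤ d) (A : Finset (Fin d → ℤ))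
    (hfin : (obdry (A : Set (Fin d → ℤ))).Finite) :
    A.card ≤ (obdry (A : Set (Fin d → ℤ))).ncard ^ 2 := by
  classical
  let i₀ : Fin d := ⟨0, by omega⟩
  let i₁ : Fin d := ⟨1, by omega⟩
  have hne : i₀ ≠ i₁ := by simp [i₀, i₁]
  choose! f hf hf' using exists_top A i₀
  choose! g hg hg' using exists_top A i₁
  rw [Set.ncard_eq_toFinset_card _ hfin, sq, ← Finset.card_product]
  refine Finset.card_le_card_of_injOn (fun x => (f x, g x)) ?_ ?_
  · intro x hx
    simp only [Finset.coe_product, Set.mem_prod, Finset.mem_coe, Set.Finite.mem_toFinset]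
    exact ⟨hf x hx, hg x hx⟩
  · intro x hx z hz h
    simp only [Prod.mk.injEq] at h
    funext j
    by_cases hj : j = i₀
    · have hj1 : j ≠ i₁ := by rw [hj]; exact hne
      rw [← hg' x hx j hj1, ← hg' z hz j hj1, h.2]
    · rw [← hf' x hx j hj, ← hf' z hz j hj, h.1]

/-- The one-step weights. -/
noncomputable def stepW {d : ℕ} (A : Finset (Fin d → ℤ)) (v : Fin d → ℤ) : ENNReal :=
  ENNReal.ofReal (unifFam (obdry (A : Set (Fin d → ℤ))) v)

lemma stepW_ne_zero {d : ℕ} {A : Finset (Fin d → ℤ)} {v : Fin d → ℤ} (h : stepW A v ≠ 0) :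
    v ∈ obdry (A : Set (Fin d → ℤ)) := by
  by_contra hv
  apply h
  simp [stepW, unifFam, hv]

lemma stepW_le {d : ℕ} (hd : 2 ≤ d) (A : Finset (Fin d → ℤ)) (v : Fin d → ℤ) (hA : 0 < A.card) :
    stepW A v ≤ ENNReal.ofReal (1 / Real.sqrt A.card) := by
  apply ENNReal.ofReal_le_ofReal
  unfold unifFam
  split_ifs
  · by_cases hfin : (obdry (A : Set (Fin d → ℤ))).Finite
    · have h := card_le_sq hd A hfin
      have h' : (A.card : ℝ) ≤ ((obdry (A : Set (Fin d → ℤ))).ncard : ℝ) ^ 2 := by exact_mod_cast h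
      apply one_div_le_one_div_of_le
      · positivity
      · rw [Real.sqrt_le_left (by positivity)]
        exact h'
    · rw [Set.Infinite.ncard hfin]
      simp
  · positivity

lemma tsum_stepW_le {d : ℕ} (A : Finset (Fin d → ℤ)) : ∑' v, stepW A v ≤ 1 := by
  classical
  by_cases hfin : (obdry (A : Set (Fin d → ℤ))).Finite
  · rw [tsum_eq_sum (s := hfin.toFinset)]
    · have : ∀ v ∈ hfin.toFinset, stepW A v =
          ENNReal.ofReal (1 / (hfin.toFinset.card : ℝ)) := by
        intro v hv
        rw [Set.Finite.mem_toFinset] at hv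
        simp only [stepW, unifFam, hv, if_true]
        rw [Set.ncard_eq_toFinset_card _ hfin]
      rw [Finset.sum_congr rfl this, ← ENNReal.ofReal_sum_of_nonneg (by intros; positivity)]
      rw [← ENNReal.ofReal_one]
      apply ENNReal.ofReal_le_ofReal
      rw [Finset.sum_const, nsmul_eq_mul, mul_one_div]
      exact div_self_le_one _
    · intro v hv
      by_contra h
      exact hv (by simpa using stepW_ne_zero h)
  · have : ∀ v, stepW A v = 0 := by
      intro v
      unfold stepW unifFam
      rw [Set.Infinite.ncard hfin]
      simp
    simp [this]

/-! ### The weighted chain-counting function -/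

/-- The offsets containing all nearest neighbours. -/
noncomputable def nbrs (d : ℕ) : Finset (Fin d → ℤ) := Finset.Icc (-1) 1

/-- The exponential weight. -/
noncomputable def eC : ENNReal := ENNReal.ofReal (Real.exp 1)

open Classical in
/-- `G n A x`: the expected exponentially weighted number of chains from `0` to `x` in the
cluster, on the event that the cluster of size `n + 1` is `A`. -/
noncomputable def chainG {d : ℕ} : ℕ → Finset (Fin d → ℤ) → (Fin d → ℤ) → ENNReal
  | 0, A, x => if A = {0} then (if x = 0 then 1 else 0) else 0
  | n + 1, B, x => ∑' A : Finset (Fin d → ℤ), ∑' v : Fin d → ℤ,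
      if B = insert v A then
        stepW A v * (chainG n A x +
          if x = v then eC * ∑ u ∈ nbrs d, chainG n A (x + u) else 0) else 0

/-- Total mass of `chainG`. -/
noncomputable def totG (d n : ℕ) : ENNReal :=
  ∑' A : Finset (Fin d → ℤ), ∑' x : Fin d → ℤ, chainG n A x

lemma chainG_card {d : ℕ} (n : ℕ) (A : Finset (Fin d → ℤ)) (x : Fin d → ℤ)
    (h : chainG n A x ≠ 0) : A.card = n + 1 := by
  induction n generalizing A x with
  | zero =>
    simp only [chainG, ne_eq, ite_eq_right_iff, Classical.not_imp] at h
    rw [h.1]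
    simp
  | succ n ih =>
    rw [chainG] at h
    obtain ⟨A', h⟩ := not_forall.1 (fun h' => h (ENNReal.tsum_eq_zero.2 h'))
    obtain ⟨v, h⟩ := not_forall.1 (fun h' => h (ENNReal.tsum_eq_zero.2 h'))
    split_ifs at h with h1 h2
    · have hw := stepW_ne_zero (left_ne_zero_of_mul h)
      have hc : A'.card = n + 1 := by
        by_contra hc
        have h0 : ∀ x, chainG n A' x = 0 := fun x => by
          by_contra h'
          exact hc (ih A' x h')
        simp [h0] at h
      rw [h1, Finset.card_insert_of_notMem (by simpa using hw.1), hc]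
    · have hw := stepW_ne_zero (left_ne_zero_of_mul h)
      have hc : A'.card = n + 1 := by
        by_contra hc
        have h0 : ∀ x, chainG n A' x = 0 := fun x => by
          by_contra h'
          exact hc (ih A' x h')
        simp [h0] at h
      rw [h1, Finset.card_insert_of_notMem (by simpa using hw.1), hc]
    · exact absurd rfl h

lemma totG_zero (d : ℕ) : totG d 0 = 1 := by
  unfold totG
  rw [tsum_eq_single {0}]
  · rw [tsum_eq_single 0]
    · simp [chainG]
    · intro x hx
      simp [chainG, hx]
  · intro A hA
    simp [chainG, hA]

lemma totG_succ {d : ℕ} (hd : 2 ≤ d) (n : ℕ) :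
    totG d (n + 1) ≤ totG d n *
      (1 + ENNReal.ofReal (1 / Real.sqrt (n + 1 : ℕ)) * eC * (nbrs d).card) := by
  classical
  have key : totG d (n + 1) = ∑' A : Finset (Fin d → ℤ), ∑' v : Fin d → ℤ, ∑' x : Fin d → ℤ,
      stepW A v * (chainG n A x +
          if x = v then eC * ∑ u ∈ nbrs d, chainG n A (x + u) else 0) := by
    unfold totG
    simp only [chainG]
    rw [ENNReal.tsum_comm]
    have : ∀ x : Fin d → ℤ, ∑' (B : Finset (Fin d → ℤ)), ∑' (A : Finset (Fin d → ℤ)),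
        ∑' (v : Fin d → ℤ), (if B = insert v A then
        stepW A v * (chainG n A x +
          if x = v then eC * ∑ u ∈ nbrs d, chainG n A (x + u) else 0) else 0) =
        ∑' (A : Finset (Fin d → ℤ)), ∑' (v : Fin d → ℤ), stepW A v * (chainG n A x +
          if x = v then eC * ∑ u ∈ nbrs d, chainG n A (x + u) else 0) := by
      intro x
      rw [ENNReal.tsum_comm]
      refine tsum_congr fun A => ?_
      rw [ENNReal.tsum_comm]
      refine tsum_congr fun v => ?_
      rw [tsum_ite_eq]
    rw [tsum_congr this, ENNReal.tsum_comm]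
    refine tsum_congr fun A => ?_
    rw [ENNReal.tsum_comm]
  rw [key]
  unfold totG
  rw [← ENNReal.tsum_mul_right]
  refine ENNReal.tsum_le_tsum fun A => ?_
  by_cases hA : A.card = n + 1
  swap
  · have h0 : ∀ x, chainG n A x = 0 := fun x => by
      by_contra h'
      exact hA (chainG_card n A x h')
    simp [h0]
  have h1 : ∀ v : Fin d → ℤ, ∑' x : Fin d → ℤ, stepW A v * (chainG n A x +
          (if x = v then eC * ∑ u ∈ nbrs d, chainG n A (x + u) else 0)) =
      stepW A v * (∑' x, chainG n A x) +
        stepW A v * (eC * ∑ u ∈ nbrs d, chainG n A (v + u)) := by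
    intro v
    rw [ENNReal.tsum_mul_left, ENNReal.tsum_add, mul_add, tsum_ite_eq]
  rw [tsum_congr h1, ENNReal.tsum_add, mul_add, mul_one]
  refine add_le_add ?_ ?_
  · rw [ENNReal.tsum_mul_right]
    calc _ ≤ 1 * ∑' x, chainG n A x := by gcongr; exact tsum_stepW_le A
      _ = _ := one_mul _
  · calc ∑' v, stepW A v * (eC * ∑ u ∈ nbrs d, chainG n A (v + u))
        ≤ ∑' v, ENNReal.ofReal (1 / Real.sqrt (n + 1 : ℕ)) *
            (eC * ∑ u ∈ nbrs d, chainG n A (v + u)) := by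
          refine ENNReal.tsum_le_tsum fun v => ?_
          gcongr
          have := stepW_le hd A v (by omega)
          rwa [hA] at this
      _ = ENNReal.ofReal (1 / Real.sqrt (n + 1 : ℕ)) *
            (eC * ∑ u ∈ nbrs d, ∑' v, chainG n A (v + u)) := by
          rw [ENNReal.tsum_mul_left, ENNReal.tsum_mul_left,
            Summable.tsum_finsetSum (fun _ _ => ENNReal.summable)]
      _ = ENNReal.ofReal (1 / Real.sqrt (n + 1 : ℕ)) *
            (eC * ∑ u ∈ nbrs d, ∑' v, chainG n A v) := by
          congr 2
          refine Finset.sum_congr rfl fun u _ => ?_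
          exact (Equiv.addRight u).tsum_eq (fun v => chainG n A v)
      _ = _ := by
          rw [Finset.sum_const, nsmul_eq_mul]
          ring
      _ ≤ _ := le_rfl

/-- The growth constant. -/
noncomputable def growC (d : ℕ) : ℝ := 3 * (Real.exp 1 * (nbrs d).card)

lemma totG_le {d : ℕ} (hd : 2 ≤ d) (n : ℕ) :
    totG d n ≤ ENNReal.ofReal (Real.exp (growC d * Real.sqrt (n + 1 : ℕ))) := by
  induction n with
  | zero =>
    rw [totG_zero, ← ENNReal.ofReal_one]
    apply ENNReal.ofReal_le_ofReal
    apply Real.one_le_exp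
    unfold growC
    positivity
  | succ n ih =>
    refine (totG_succ hd n).trans ?_
    set b : ℝ := Real.exp 1 * (nbrs d).card with hb
    have hb0 : 0 ≤ b := by positivity
    have h1 : 1 + ENNReal.ofReal (1 / Real.sqrt (n + 1 : ℕ)) * eC * (nbrs d).card
        = ENNReal.ofReal (1 + 1 / Real.sqrt (n + 1 : ℕ) * b) := by
      rw [ENNReal.ofReal_add (by norm_num) (by positivity), ENNReal.ofReal_one,
        ENNReal.ofReal_mul (by positivity), hb, ENNReal.ofReal_mul (by positivity),
        ENNReal.ofReal_natCast, eC, mul_assoc]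
    rw [h1]
    refine (mul_le_mul_left ih _).trans ?_
    rw [← ENNReal.ofReal_mul (by positivity)]
    apply ENNReal.ofReal_le_ofReal
    set s := Real.sqrt (n + 1 : ℕ) with hs
    set t := Real.sqrt (n + 1 + 1 : ℕ) with ht
    have hs2 : s ^ 2 = n + 1 := by rw [hs, Real.sq_sqrt (by positivity)]; push_cast; ring
    have ht2 : t ^ 2 = n + 2 := by rw [ht, Real.sq_sqrt (by positivity)]; push_cast; ring
    have hn : (0 : ℝ) ≤ n := by positivity
    have hs0 : 0 < s := Real.sqrt_pos.2 (by positivity)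
    have ht0 : 0 < t := Real.sqrt_pos.2 (by positivity)
    have hts : t ≤ 2 * s := by
      by_contra! h
      nlinarith
    have hdiff : 1 / s ≤ 3 * (t - s) := by
      rw [div_le_iff₀ hs0]
      have h3 : (t - s) * (t + s) = 1 := by nlinarith
      have h4 : 0 ≤ t - s := by
        by_contra! h
        nlinarith
      nlinarith
    calc Real.exp (growC d * s) * (1 + 1 / s * b)
        ≤ Real.exp (growC d * s) * Real.exp (1 / s * b) := by
          gcongr
          linarith [Real.add_one_le_exp (1 / s * b)]
      _ = Real.exp (growC d * s + 1 / s * b) := (Real.exp_add _ _).symm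
      _ ≤ Real.exp (growC d * t) := by
          apply Real.exp_le_exp.2
          have : growC d = 3 * b := rfl
          rw [this]
          nlinarith

/-! ### Norm facts -/

lemma zNorm_eq {d : ℕ} (x : Fin d → ℤ) :
    zNorm x = ‖(WithLp.toLp 2 (fun i => (x i : ℝ)) : EuclideanSpace ℝ (Fin d))‖ := by
  rw [EuclideanSpace.norm_eq]
  simp [zNorm]

lemma zNorm_zero {d : ℕ} : zNorm (0 : Fin d → ℤ) = 0 := by simp [zNorm]

lemma zNorm_le_of_adj {d : ℕ} {x z : Fin d → ℤ} (h : adjPt x z) : zNorm z ≤ 1 + zNorm x := by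
  unfold adjPt at h
  rw [← h, zNorm_eq, zNorm_eq, zNorm_eq]
  have : (WithLp.toLp 2 (fun i => ((x - z) i : ℝ)) : EuclideanSpace ℝ (Fin d)) =
      WithLp.toLp 2 (fun i => (x i : ℝ)) - WithLp.toLp 2 (fun i => (z i : ℝ)) := by
    ext i
    simp
  rw [this, norm_sub_rev, add_comm]
  exact norm_le_norm_add_norm_sub' _ _

lemma sub_mem_nbrs {d : ℕ} {x z : Fin d → ℤ} (h : adjPt x z) : x - z ∈ nbrs d := by
  unfold adjPt zNorm at h
  rw [Real.sqrt_eq_one] at h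
  have hi : ∀ i, ((x - z) i) ^ 2 ≤ 1 := by
    intro i
    have : (((x - z) i : ℤ) : ℝ) ^ 2 ≤ 1 := by
      rw [← h]
      exact Finset.single_le_sum (f := fun i => (((x - z) i : ℤ) : ℝ) ^ 2)
        (fun _ _ => sq_nonneg _) (Finset.mem_univ i)
    exact_mod_cast this
  unfold nbrs
  rw [Finset.mem_Icc]
  constructor <;> intro i <;> have := abs_le_one_iff_mul_self_le_one.2 (by simpa [sq] using hi i)
  · exact (abs_le.1 this).1
  · exact (abs_le.1 this).2

/-- The exponential weight of a point. -/
noncomputable def wt {d : ℕ} (x : Fin d → ℤ) : ENNReal := ENNReal.ofReal (Real.exp (zNorm x))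

lemma wt_le_of_adj {d : ℕ} {x z : Fin d → ℤ} (h : adjPt x z) : wt z ≤ eC * wt x := by
  unfold wt eC
  rw [← ENNReal.ofReal_mul (by positivity), ← Real.exp_add]
  exact ENNReal.ofReal_le_ofReal (Real.exp_le_exp.2 (zNorm_le_of_adj h))

/-! ### The comparison -/

lemma prob_le_chainG {d : ℕ} {Ω : Type*} [MeasurableSpace Ω]
    (P : Measure Ω) [IsProbabilityMeasure P]
    (F : ℕ → Ω → Finset (Fin d → ℤ)) (y : ℕ → Ω → (Fin d → ℤ))
    (hagg : IsIncrementalAggregation P unifFam F y) (n : ℕ) (A : Finset (Fin d → ℤ))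
    (x : Fin d → ℤ) (hx : x ∈ A) :
    P {ω | F (n + 1) ω = A} * wt x ≤ chainG n A x := by
  classical
  obtain ⟨hinit, hins, hlaw⟩ := hagg
  induction n generalizing A x with
  | zero =>
    by_cases hA : A = {0}
    · subst hA
      have hx0 : x = 0 := by simpa using hx
      subst hx0
      simp only [chainG, wt, zNorm_zero, Real.exp_zero, ENNReal.ofReal_one, if_true, mul_one]
      exact prob_le_one
    · have : P {ω | F (0 + 1) ω = A} = 0 := by
        refine measure_mono_null ?_ (ae_iff.1 hinit)
        intro ω hω h
        exact hA (by rw [← hω]; exact h.1)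
      rw [this, zero_mul]
      exact zero_le
  | succ n ih =>
    have hsub : {ω | F (n + 1 + 1) ω = A} ⊆ ⋃ (B : Finset (Fin d → ℤ)), ⋃ (v : Fin d → ℤ),
        (if A = insert v B then {ω | y (n + 1 + 1) ω = v} ∩ {ω | F (n + 1) ω = B} else ∅) := by
      intro ω hω
      simp only [Set.mem_iUnion]
      refine ⟨F (n + 1) ω, y (n + 1 + 1) ω, ?_⟩
      have hω' : F (n + 1 + 1) ω = A := hω
      rw [if_pos (by rw [← hω', hins (n + 1) (by omega) ω])]
      exact ⟨rfl, rfl⟩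
    have hP : P {ω | F (n + 1 + 1) ω = A} ≤ ∑' (B : Finset (Fin d → ℤ)), ∑' (v : Fin d → ℤ),
        (if A = insert v B then stepW B v * P {ω | F (n + 1) ω = B} else 0) := by
      refine (measure_mono hsub).trans ((measure_iUnion_le _).trans ?_)
      refine ENNReal.tsum_le_tsum fun B => (measure_iUnion_le _).trans ?_
      refine ENNReal.tsum_le_tsum fun v => ?_
      split_ifs
      · exact (hlaw (n + 1) (by omega) B v).le
      · simp
    refine (mul_le_mul_left hP _).trans ?_
    rw [← ENNReal.tsum_mul_right]
    simp only [chainG]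
    refine ENNReal.tsum_le_tsum fun B => ?_
    rw [← ENNReal.tsum_mul_right]
    refine ENNReal.tsum_le_tsum fun v => ?_
    by_cases hA : A = insert v B
    swap
    · simp [hA]
    rw [if_pos hA, if_pos hA, mul_assoc]
    by_cases hw : stepW B v = 0
    · simp [hw]
    refine mul_le_mul_right ?_ _
    by_cases hxB : x ∈ B
    · exact (ih B x hxB).trans le_self_add
    · have hxv : x = v := by
        rw [hA, Finset.mem_insert] at hx
        exact hx.resolve_right hxB
      rw [if_pos hxv]
      refine le_trans ?_ le_add_self
      obtain ⟨_, z, hz, hadj⟩ := stepW_ne_zero hw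
      rw [← hxv] at hadj
      calc P {ω | F (n + 1) ω = B} * wt x
          ≤ P {ω | F (n + 1) ω = B} * (eC * wt z) := by
            gcongr
            exact wt_le_of_adj hadj
        _ = eC * (P {ω | F (n + 1) ω = B} * wt z) := by ring
        _ ≤ eC * chainG n B z := by
            gcongr
            exact ih B z hz
        _ = eC * chainG n B (x + (z - x)) := by rw [add_sub_cancel]
        _ ≤ _ := by
            gcongr
            exact Finset.single_le_sum (f := fun u => chainG n B (x + u))
              (fun _ _ => zero_le) (sub_mem_nbrs hadj)

lemma tail_bound {d : ℕ} (hd : 2 ≤ d) {Ω : Type*} [MeasurableSpace Ω]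
    (P : Measure Ω) [IsProbabilityMeasure P]
    (F : ℕ → Ω → Finset (Fin d → ℤ)) (y : ℕ → Ω → (Fin d → ℤ))
    (hagg : IsIncrementalAggregation P unifFam F y) (n : ℕ) :
    P {ω | (growC d + 1) * Real.sqrt (n + 1 : ℕ) < rad (F (n + 1) ω)} ≤
      ENNReal.ofReal (24 * (1 / ((n + 1 : ℕ) : ℝ) ^ 2)) := by
  classical
  set s := Real.sqrt (n + 1 : ℕ) with hs
  have hs0 : 0 ≤ s := Real.sqrt_nonneg _
  have hg : 0 ≤ growC d := by unfold growC; positivity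
  set R := (growC d + 1) * s with hR
  have hR0 : 0 ≤ R := by positivity
  set w : ENNReal := ENNReal.ofReal (Real.exp R) with hw
  have hw0 : w ≠ 0 := by simp [hw, Real.exp_pos]
  have hwt : w ≠ ⊤ := ENNReal.ofReal_ne_top
  have h1 : P {ω | R < rad (F (n + 1) ω)} * w ≤ totG d n := by
    have hsub : {ω | R < rad (F (n + 1) ω)} ⊆ ⋃ (A : Finset (Fin d → ℤ)),
        (if R < rad A then {ω | F (n + 1) ω = A} else ∅) := by
      intro ω hω
      simp only [Set.mem_iUnion]
      refine ⟨F (n + 1) ω, ?_⟩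
      have hω' : R < rad (F (n + 1) ω) := hω
      rw [if_pos hω']
      rfl
    refine (mul_le_mul_left ((measure_mono hsub).trans (measure_iUnion_le _)) _).trans ?_
    rw [← ENNReal.tsum_mul_right]
    unfold totG
    refine ENNReal.tsum_le_tsum fun A => ?_
    split_ifs with hA
    · have hne : A.Nonempty := by
        by_contra hne
        simp only [rad, hne, dite_false] at hA
        linarith
      simp only [rad, hne, dite_true] at hA
      rw [Finset.lt_sup'_iff] at hA
      obtain ⟨x, hx, hRx⟩ := hA
      calc P {ω | F (n + 1) ω = A} * w ≤ P {ω | F (n + 1) ω = A} * wt x := by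
            gcongr
            exact ENNReal.ofReal_le_ofReal (Real.exp_le_exp.2 hRx.le)
        _ ≤ chainG n A x := prob_le_chainG P F y hagg n A x hx
        _ ≤ _ := ENNReal.le_tsum x
    · simp
  have h2 := h1.trans (totG_le hd n)
  rw [← ENNReal.le_div_iff_mul_le (Or.inl hw0) (Or.inl hwt), hw,
    ← ENNReal.ofReal_div_of_pos (Real.exp_pos _), ← Real.exp_sub] at h2
  refine h2.trans (ENNReal.ofReal_le_ofReal ?_)
  have h3 : growC d * s - R = -s := by rw [hR]; ring
  rw [← hs, h3, Real.exp_neg]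
  have h4 := Real.pow_div_factorial_le_exp s hs0 4
  have hs4 : s ^ 4 = ((n + 1 : ℕ) : ℝ) ^ 2 := by
    rw [show s ^ 4 = (s ^ 2) ^ 2 by ring, hs, Real.sq_sqrt (by positivity)]
  rw [hs4] at h4
  have hp : (0 : ℝ) < ((n + 1 : ℕ) : ℝ) ^ 2 := by positivity
  have h5 : 24 * (1 / ((n + 1 : ℕ) : ℝ) ^ 2) = (((n + 1 : ℕ) : ℝ) ^ 2 / (Nat.factorial 4))⁻¹ := by
    rw [inv_div]
    simp [Nat.factorial]
    ring
  rw [h5]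
  exact inv_anti₀ (by positivity) h4

/-- for the Eden growth model in `ℤ^d` (incremental aggregation with the
uniform distributions), there is `c > 0` with almost surely `rad(F_n) ≤ c·n^{1/2}`
for all sufficiently large `n`. -/
theorem stmt4 {d : ℕ} (hd : 2 ≤ d) {Ω : Type*} [MeasurableSpace Ω]
    (P : Measure Ω) [IsProbabilityMeasure P]
    (F : ℕ → Ω → Finset (Fin d → ℤ)) (y : ℕ → Ω → (Fin d → ℤ))
    (hagg : IsIncrementalAggregation P unifFam F y) :
    ∃ c : ℝ, 0 < c ∧
      P {ω | ∃ N : ℕ, ∀ n : ℕ, N ≤ n →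
        rad (F n ω) ≤ c * (n : ℝ) ^ ((1 : ℝ) / 2)} = 1 := by
  have hg : 0 ≤ growC d := by unfold growC; positivity
  refine ⟨growC d + 1, by linarith, ?_⟩
  have hsum : ∑' n : ℕ, P {ω | (growC d + 1) * Real.sqrt (n + 1 : ℕ) < rad (F (n + 1) ω)} ≠ ⊤ := by
    have hS : Summable (fun n : ℕ => 24 * (1 / ((n + 1 : ℕ) : ℝ) ^ 2)) :=
      ((summable_nat_add_iff 1).2 (Real.summable_one_div_nat_pow.2 (by norm_num))).mul_left 24
    exact ne_top_of_le_ne_top hS.tsum_ofReal_ne_top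
      (ENNReal.tsum_le_tsum fun n => tail_bound hd P F y hagg n)
  have hae := ae_eventually_notMem hsum
  rw [← measure_univ (μ := P)]
  apply measure_congr
  filter_upwards [hae] with ω hω
  apply propext
  refine ⟨fun _ => trivial, fun _ => ?_⟩
  obtain ⟨N, hN⟩ := eventually_atTop.1 hω
  refine ⟨N + 1, fun n hn => ?_⟩
  obtain ⟨m, rfl⟩ : ∃ m, n = m + 1 := ⟨n - 1, by omega⟩
  have := hN m (by omega)
  rw [← Real.sqrt_eq_rpow]
  exact not_lt.1 this
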